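/- For every non-negative integer n, \(25 \sum_{k=0}^{n} \binom{2n}{n+k} F_{k}^{4} = 3^{2n} - 4(-1)^{n} + 3 \cdot 2^{2n}\). -/

import Mathlib

/-- If `x * y = 1`, pairing the terms `C(2n, n + k)` and `C(2n, n - k)` of the expansion of
`y ^ n * (1 + x) ^ (2 * n) = (x + y + 2) ^ n` counts the central term twice. -/
theorem sum_choose_mul_pow_add_pow {R : Type*} [CommRing R] {x y : R} (hxy : x * y = 1) (n : ℕ) :
    ∑ k ∈ Finset.range (n + 1), ((2 * n).choose (n + k) : R) * (x ^ k + y ^ k) =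
      (x + y + 2) ^ n + ((2 * n).choose n : R) := by
  have hpow (m : ℕ) : y ^ m * x ^ m = 1 := by rw [← mul_pow, mul_comm y, hxy, one_pow]
  have hexp : (x + y + 2) ^ n =
      y ^ n * ∑ j ∈ Finset.range (n + (n + 1)), x ^ j * ((2 * n).choose j : R) := by
    have hbase : x + y + 2 = y * (x + 1) ^ 2 := by linear_combination (-x - 2) * hxy
    have hbinom := add_pow x 1 (2 * n)
    simp only [one_pow, mul_one] at hbinom
    rw [hbase, mul_pow, ← pow_mul, hbinom, show n + (n + 1) = 2 * n + 1 by ring]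
  have hlow : y ^ n * ∑ j ∈ Finset.range n, x ^ j * ((2 * n).choose j : R) =
      ∑ k ∈ Finset.range n, ((2 * n).choose (n + (k + 1)) : R) * y ^ (k + 1) := by
    rw [← Finset.sum_range_reflect, Finset.mul_sum]
    refine Finset.sum_congr rfl fun k hk => ?_
    have hk := Finset.mem_range.mp hk
    rw [Nat.choose_symm_of_eq_add (show 2 * n = (n - 1 - k) + (n + (k + 1)) by omega)]
    have hy : y ^ n = y ^ (k + 1) * y ^ (n - 1 - k) := by
      rw [← pow_add]; congr 1; omega
    rw [hy]
    linear_combination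
      y ^ (k + 1) * ((2 * n).choose (n + (k + 1)) : R) * hpow (n - 1 - k)
  have hhigh : y ^ n * ∑ k ∈ Finset.range (n + 1), x ^ (n + k) * ((2 * n).choose (n + k) : R) =
      ∑ k ∈ Finset.range (n + 1), ((2 * n).choose (n + k) : R) * x ^ k := by
    rw [Finset.mul_sum]
    refine Finset.sum_congr rfl fun k _ => ?_
    rw [pow_add]
    linear_combination x ^ k * ((2 * n).choose (n + k) : R) * hpow n
  rw [hexp, Finset.sum_range_add _ n (n + 1), mul_add, hlow, hhigh]
  simp only [mul_add, Finset.sum_add_distrib]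
  rw [Finset.sum_range_succ' (fun k => ((2 * n).choose (n + k) : R) * y ^ k)]
  simp only [add_zero, pow_zero, mul_one]
  ring

open Real in
/-- The Binet expansion of the fourth power of a Fibonacci number. -/
theorem twenty_five_mul_fib_pow_four (k : ℕ) :
    25 * (Nat.fib k : ℝ) ^ 4 =
      ((goldenRatio ^ 4) ^ k + (goldenConj ^ 4) ^ k) -
        4 * ((-goldenRatio ^ 2) ^ k + (-goldenConj ^ 2) ^ k) + 3 * (1 ^ k + 1 ^ k) := by
  have hsqrt : (√5 : ℝ) ^ 2 = 5 := sq_sqrt (by norm_num)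
  have hfib : √5 * (Nat.fib k : ℝ) = goldenRatio ^ k - goldenConj ^ k := by
    rw [coe_fib_eq]; field_simp
  have hleft : 25 * (Nat.fib k : ℝ) ^ 4 = (goldenRatio ^ k - goldenConj ^ k) ^ 4 := by
    rw [← hfib]
    linear_combination (-(Nat.fib k : ℝ) ^ 4 * (√5 ^ 2 + 5)) * hsqrt
  have hprod : goldenRatio ^ k * goldenConj ^ k = (-1) ^ k := by
    rw [← mul_pow, goldenRatio_mul_goldenConj]
  have hsign : ((-1 : ℝ) ^ k) ^ 2 = 1 := by rw [← pow_mul, mul_comm, pow_mul]; simp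
  rw [hleft, neg_pow (goldenRatio ^ 2), neg_pow (goldenConj ^ 2), ← hprod]
  rw [← hprod] at hsign
  simp only [one_pow, pow_right_comm _ _ k]
  linear_combination 6 * hsign

/-- For every non-negative integer `n`,
`25 ∑_{k=0}^n C(2n, n+k) F_k⁴ = 3^{2n} - 4(-1)^n + 3·2^{2n}` (as integers). -/
theorem sum_choose_fib_fourth (n : ℕ) :
    25 * ∑ k ∈ Finset.range (n + 1),
        ((Nat.choose (2 * n) (n + k) : ℤ) * (Nat.fib k : ℤ) ^ 4) =
      3 ^ (2 * n) - 4 * (-1) ^ n + 3 * 2 ^ (2 * n) := by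
  have hsq₁ := Real.goldenRatio_sq
  have hsq₂ := Real.goldenConj_sq
  have hadd := Real.goldenRatio_add_goldenConj
  have hmul := Real.goldenRatio_mul_goldenConj
  set a := Real.goldenRatio
  set b := Real.goldenConj
  have hsum₂ : a ^ 2 + b ^ 2 = 3 := by linear_combination hsq₁ + hsq₂ + hadd
  have hmul₂ : a ^ 2 * b ^ 2 = 1 := by rw [← mul_pow, hmul]; norm_num
  have hmul₄ : a ^ 4 * b ^ 4 = 1 := by rw [← mul_pow, hmul]; norm_num
  have hsum₄ : a ^ 4 + b ^ 4 + 2 = 3 ^ 2 := by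
    linear_combination (a ^ 2 + b ^ 2 + 3) * hsum₂ - 2 * hmul₂
  have h₄ := sum_choose_mul_pow_add_pow hmul₄ n
  have h₂ := sum_choose_mul_pow_add_pow
    (show -a ^ 2 * -b ^ 2 = 1 by linear_combination hmul₂) n
  have h₀ := sum_choose_mul_pow_add_pow (mul_one (1 : ℝ)) n
  rw [hsum₄, ← pow_mul] at h₄
  rw [show -a ^ 2 + -b ^ 2 + 2 = -1 by linear_combination -hsum₂] at h₂
  rw [show (1 : ℝ) + 1 + 2 = 2 ^ 2 by norm_num, ← pow_mul] at h₀
  have hreal : 25 * ∑ k ∈ Finset.range (n + 1),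
      (((2 * n).choose (n + k) : ℝ) * (Nat.fib k : ℝ) ^ 4) =
      3 ^ (2 * n) - 4 * (-1) ^ n + 3 * 2 ^ (2 * n) := by
    trans ∑ k ∈ Finset.range (n + 1), ((2 * n).choose (n + k) : ℝ) * ((a ^ 4) ^ k + (b ^ 4) ^ k) -
        4 * ∑ k ∈ Finset.range (n + 1),
          ((2 * n).choose (n + k) : ℝ) * ((-a ^ 2) ^ k + (-b ^ 2) ^ k) +
        3 * ∑ k ∈ Finset.range (n + 1), ((2 * n).choose (n + k) : ℝ) * (1 ^ k + 1 ^ k)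
    · simp only [Finset.mul_sum, ← Finset.sum_sub_distrib, ← Finset.sum_add_distrib]
      refine Finset.sum_congr rfl fun k _ => ?_
      linear_combination ((2 * n).choose (n + k) : ℝ) * twenty_five_mul_fib_pow_four k
    · linear_combination h₄ - 4 * h₂ + 3 * h₀
  exact_mod_cast hreal
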